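/- Let Q be a Feller Markov kernel on a Polish space X and let d be a continuous, [0,1]-valued distance-like function on X×X which is contracting for Q with constant α < 1. Then there exist α̃ < 1 and a Markov kernel T on X×X such that, for every (x,y) ∈ X×X, the transition probability T((x,y),·) is a coupling of Q(x,·) and Q(y,·), and the inequality ∫ d dT((x,y),·) ≤ α̃ d(x,y) holds for every (x,y) with d(x,y) < 1. -/

import Mathlib

open MeasureTheory ProbabilityTheory Filter Topology BoundedContinuousFunction
open scoped ENNReal NNReal

noncomputable section

/-- A coupling of two measures: a measure on the product with the given marginals. -/
def IsCoupling {α β : Type*} [MeasurableSpace α] [MeasurableSpace β]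
    (π : Measure (α × β)) (μ : Measure α) (ν : Measure β) : Prop :=
  π.map Prod.fst = μ ∧ π.map Prod.snd = ν

/-- The lift of a distance-like function `d` to probability measures. -/
def liftDist {α : Type*} [MeasurableSpace α] (d : α → α → ℝ) (μ ν : Measure α) : ℝ≥0∞ :=
  sInf {r : ℝ≥0∞ | ∃ π : Measure (α × α), IsCoupling π μ ν ∧
    r = ∫⁻ p, ENNReal.ofReal (d p.1 p.2) ∂π}

/-- Countably many kernels can be glued along a countable measurable cover. -/
lemma ProbabilityTheory.Kernel.exists_forall_eq_of_cover {E F : Type*} [MeasurableSpace E]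
    [MeasurableSpace F] (K : ℕ → Kernel E F) (S : ℕ → Set E) (hS : ∀ n, MeasurableSet (S n))
    (hcov : ∀ p, ∃ n, p ∈ S n) :
    ∃ T : Kernel E F, ∀ p, ∃ n, p ∈ S n ∧ T p = K n p := by
  classical
  refine ⟨⟨fun p => K (Nat.find (hcov p)) p, ?_⟩, fun p => ⟨_, Nat.find_spec (hcov p), rfl⟩⟩
  exact Measurable.find (f := fun n p => K n p) (p := fun n p => p ∈ S n)
    (fun n => (K n).measurable) hS hcov

/-- On a separable metrizable space there are continuous partitions of unity of arbitrarily
small mesh, written with values in `ℝ≥0∞`. -/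
lemma exists_partition_ball {X : Type*} [MetricSpace X] [SecondCountableTopology X] [Nonempty X]
    {r : ℝ} (hr : 0 < r) :
    ∃ φ : ℕ → X → ℝ≥0, (∀ i, Continuous (φ i)) ∧ (∀ u, ∑' i, (φ i u : ℝ≥0∞) = 1) ∧
      ∃ c : ℕ → X, ∀ i u, φ i u ≠ 0 → dist u (c i) < r := by
  obtain ⟨f, hf⟩ := PartitionOfUnity.exists_isSubordinate (isClosed_univ (X := X))
    (fun i => Metric.ball (TopologicalSpace.denseSeq X i) r) (fun i => Metric.isOpen_ball) (by
      intro u _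
      obtain ⟨i, hv⟩ := (TopologicalSpace.denseRange_denseSeq X).exists_mem_open
        Metric.isOpen_ball ⟨u, Metric.mem_ball_self hr⟩
      exact Set.mem_iUnion.2 ⟨i, Metric.mem_ball_comm.1 hv⟩)
  refine ⟨fun i u => (f i u).toNNReal, fun i => continuous_real_toNNReal.comp (f i).continuous,
    fun u => ?_, TopologicalSpace.denseSeq X, fun i u hu => ?_⟩
  · have hfin : (Function.support fun i => f i u).Finite := f.locallyFinite.point_finite u
    have h1 : ∑' i, f i u = 1 := by
      rw [tsum_eq_finsum hfin]; exact f.sum_eq_one (Set.mem_univ u)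
    have hs : Summable fun i => f i u := summable_of_hasFiniteSupport hfin
    change ∑' i, ENNReal.ofReal (f i u) = 1
    rw [← ENNReal.ofReal_tsum_of_nonneg (fun i => f.nonneg i u) hs, h1, ENNReal.ofReal_one]
  · refine Metric.mem_ball.1 (hf i (subset_tsupport _ ?_))
    intro h
    exact hu (by simp [h])

/-- The integral of a continuous function on a product is approximated from below by integrals
of finite sums of products. -/
lemma exists_finset_sum_lt {X : Type*} [TopologicalSpace X] [PolishSpace X]
    [MeasurableSpace X] [BorelSpace X] (π : Measure (X × X)) {s : X × X → ℝ≥0∞}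
    (hs : Continuous s) (hs1 : ∀ p, s p ≤ 1) {c : ℝ≥0∞} (hc : c < ∫⁻ p, s p ∂π) :
    ∃ (φ : ℕ → X → ℝ≥0) (w : ℕ × ℕ → ℝ≥0∞) (F : Finset (ℕ × ℕ)),
      (∀ i, Continuous (φ i)) ∧ (∀ u, ∑' i, (φ i u : ℝ≥0∞) = 1) ∧
      (∀ k, w k ≤ 1) ∧
      (∀ k u v, w k * (φ k.1 u * φ k.2 v) ≤ s (u, v) * (φ k.1 u * φ k.2 v)) ∧
      c < ∑ k ∈ F, w k * ∫⁻ p, φ k.1 p.1 * φ k.2 p.2 ∂π := by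
  let := TopologicalSpace.metrizableSpaceMetric X
  have : Nonempty X := by
    by_contra h
    rw [not_nonempty_iff] at h
    simp at hc
  have hpos (n : ℕ) : (0 : ℝ) < 1 / (n + 1) := by positivity
  choose φ hφc hφ1 a ha using fun n : ℕ => exists_partition_ball (X := X) (hpos n)
  let U (n i : ℕ) : Set X := Metric.ball (a n i) (1 / (n + 1))
  let w (n : ℕ) (k : ℕ × ℕ) : ℝ≥0∞ := ⨅ p ∈ U n k.1 ×ˢ U n k.2, s p
  let Φ (n : ℕ) (p : X × X) : ℝ≥0∞ := ∑' k : ℕ × ℕ, w n k * (φ n k.1 p.1 * φ n k.2 p.2)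
  have hterm (n : ℕ) (k : ℕ × ℕ) :
      Measurable fun p : X × X => (φ n k.1 p.1 * φ n k.2 p.2 : ℝ≥0∞) := by
    have h1 := (hφc n k.1).measurable
    have h2 := (hφc n k.2).measurable
    fun_prop
  have hΦm (n : ℕ) : Measurable (Φ n) :=
    Measurable.tsum fun k => (hterm n k).const_mul _
  have hone (n : ℕ) (u v : X) : ∑' k : ℕ × ℕ, (φ n k.1 u * φ n k.2 v : ℝ≥0∞) = 1 := by
    rw [ENNReal.tsum_prod (f := fun i j => (φ n i u * φ n j v : ℝ≥0∞))]
    simp_rw [ENNReal.tsum_mul_left, hφ1, mul_one, hφ1]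
  have hle (p : X × X) : s p ≤ liminf (fun n => Φ n p) atTop := by
    refine le_of_forall_lt fun e he => ?_
    obtain ⟨e', hee', he'⟩ := exists_between he
    refine hee'.trans_le (le_liminf_of_le (by isBoundedDefault) ?_)
    obtain ⟨δ, hδ, hball⟩ := Metric.isOpen_iff.1 (isOpen_lt continuous_const hs) p he'
    obtain ⟨N, hN⟩ := exists_nat_one_div_lt (half_pos hδ)
    filter_upwards [eventually_ge_atTop N] with n hn
    have hnδ : (1 : ℝ) / (n + 1) < δ / 2 := lt_of_le_of_lt (Nat.one_div_le_one_div hn) hN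
    rw [← mul_one e', ← hone n p.1 p.2, ← ENNReal.tsum_mul_left]
    refine ENNReal.tsum_le_tsum fun k => ?_
    by_cases h1 : φ n k.1 p.1 = 0
    · simp [h1]
    by_cases h2 : φ n k.2 p.2 = 0
    · simp [h2]
    refine mul_le_mul_left (le_iInf₂ fun q hq => le_of_lt (hball ?_)) _
    have d1 := ha n _ _ h1
    have d2 := ha n _ _ h2
    have e1 : dist q.1 (a n k.1) < 1 / (n + 1) := hq.1
    have e2 : dist q.2 (a n k.2) < 1 / (n + 1) := hq.2
    rw [Metric.mem_ball, Prod.dist_eq, max_lt_iff]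
    constructor
    · linarith [dist_triangle_right q.1 p.1 (a n k.1)]
    · linarith [dist_triangle_right q.2 p.2 (a n k.2)]
  have hlim : c < liminf (fun n => ∫⁻ p, Φ n p ∂π) atTop :=
    hc.trans_le ((lintegral_mono hle).trans (lintegral_liminf_le hΦm))
  obtain ⟨n, hn⟩ := (eventually_lt_of_lt_liminf hlim).exists
  have hsum : ∫⁻ p, Φ n p ∂π = ∑' k, w n k * ∫⁻ p, φ n k.1 p.1 * φ n k.2 p.2 ∂π := by
    rw [lintegral_tsum fun k => ((hterm n k).const_mul _).aemeasurable]
    exact tsum_congr fun k => lintegral_const_mul _ (hterm n k)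
  rw [hsum, ENNReal.tsum_eq_iSup_sum, lt_iSup_iff] at hn
  obtain ⟨F, hF⟩ := hn
  refine ⟨φ n, w n, F, hφc n, hφ1 n, fun k => ?_, fun k u v => ?_, hF⟩
  · exact (iInf₂_le (a n k.1, a n k.2)
      ⟨Metric.mem_ball_self (hpos n), Metric.mem_ball_self (hpos n)⟩).trans (hs1 _)
  by_cases h1 : φ n k.1 u = 0
  · simp [h1]
  by_cases h2 : φ n k.2 v = 0
  · simp [h2]
  exact mul_le_mul_left (iInf₂_le (u, v) ⟨ha n _ _ h1, ha n _ _ h2⟩) _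

/-- A sub-coupling with density `h` relative to the product measure, completed by the product of
the two missing marginals, is a coupling. -/
lemma isCoupling_withDensity {X : Type*} [MeasurableSpace X] (μ ν : Measure X)
    [IsProbabilityMeasure μ] [IsProbabilityMeasure ν] {h : X × X → ℝ≥0∞} (hh : Measurable h)
    (h1 : ∀ u, ∫⁻ v, h (u, v) ∂ν ≤ 1) (h2 : ∀ v, ∫⁻ u, h (u, v) ∂μ ≤ 1)
    (hm : ∫⁻ u, ∫⁻ v, h (u, v) ∂ν ∂μ < 1) :
    IsCoupling ((μ.prod ν).withDensity fun q => h q +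
      (1 - ∫⁻ v, h (q.1, v) ∂ν) * (1 - ∫⁻ u, h (u, q.2) ∂μ) *
        (1 - ∫⁻ u, ∫⁻ v, h (u, v) ∂ν ∂μ)⁻¹) μ ν := by
  set m := ∫⁻ u, ∫⁻ v, h (u, v) ∂ν ∂μ with hm_def
  have hm' : m = ∫⁻ v, ∫⁻ u, h (u, v) ∂μ ∂ν :=
    lintegral_lintegral_swap (f := fun u v => h (u, v)) hh.aemeasurable
  have hmeas1 : Measurable fun u => ∫⁻ v, h (u, v) ∂ν := hh.lintegral_prod_right'
  have hmeas2 : Measurable fun v => ∫⁻ u, h (u, v) ∂μ := hh.lintegral_prod_left'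
  have hm0 : 1 - m ≠ 0 := (tsub_pos_of_lt hm).ne'
  have hmt : 1 - m ≠ ∞ := ENNReal.sub_ne_top ENNReal.one_ne_top
  have hi1 : ∫⁻ u, (1 - ∫⁻ v, h (u, v) ∂ν) ∂μ = 1 - m := by
    rw [lintegral_sub hmeas1 (ne_top_of_lt hm) (ae_of_all _ h1)]; simp [hm_def]
  have hi2 : ∫⁻ v, (1 - ∫⁻ u, h (u, v) ∂μ) ∂ν = 1 - m := by
    rw [lintegral_sub hmeas2 (by rw [← hm']; exact ne_top_of_lt hm) (ae_of_all _ h2)]; simp [hm']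
  have hg : Measurable fun q : X × X => h q +
      (1 - ∫⁻ v, h (q.1, v) ∂ν) * (1 - ∫⁻ u, h (u, q.2) ∂μ) * (1 - m)⁻¹ := by
    fun_prop
  constructor
  · ext A hA
    rw [Measure.map_apply measurable_fst hA, withDensity_apply _ (measurable_fst hA),
      ← lintegral_indicator (measurable_fst hA), lintegral_prod _
        (hg.indicator (measurable_fst hA)).aemeasurable, ← lintegral_indicator_one hA]
    refine lintegral_congr fun u => ?_
    by_cases hu : u ∈ A
    · simp only [Set.indicator, Set.mem_preimage, hu, if_true, Pi.one_apply]
      rw [lintegral_add_left (by fun_prop), lintegral_mul_const _ (by fun_prop),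
        lintegral_const_mul _ (by fun_prop), hi2, mul_assoc, ENNReal.mul_inv_cancel hm0 hmt,
        mul_one, add_tsub_cancel_of_le (h1 u)]
    · simp [Set.indicator, hu]
  · ext A hA
    rw [Measure.map_apply measurable_snd hA, withDensity_apply _ (measurable_snd hA),
      ← lintegral_indicator (measurable_snd hA), lintegral_prod_symm _
        (hg.indicator (measurable_snd hA)).aemeasurable, ← lintegral_indicator_one hA]
    refine lintegral_congr fun v => ?_
    by_cases hv : v ∈ A
    · simp only [Set.indicator, Set.mem_preimage, hv, if_true, Pi.one_apply]
      rw [lintegral_add_left (by fun_prop), lintegral_mul_const _ (by fun_prop),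
        lintegral_mul_const _ (by fun_prop), hi1, mul_right_comm, ENNReal.mul_inv_cancel hm0 hmt,
        one_mul, add_tsub_cancel_of_le (h2 v)]
    · simp [Set.indicator, hv]

/-- Kernel version of `isCoupling_withDensity`. -/
lemma exists_kernel_of_density {X : Type*} [MeasurableSpace X] (Q : Kernel X X)
    [IsMarkovKernel Q] {h : X × X → ℝ≥0∞} (hh : Measurable h) :
    ∃ T : Kernel (X × X) (X × X), ∀ x y, (∀ u, ∫⁻ v, h (u, v) ∂(Q y) ≤ 1) →
      (∀ v, ∫⁻ u, h (u, v) ∂(Q x) ≤ 1) → (∫⁻ u, ∫⁻ v, h (u, v) ∂(Q y) ∂(Q x) < 1) →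
      IsCoupling (T (x, y)) (Q x) (Q y) ∧
      ∀ s : X × X → ℝ≥0∞, Measurable s →
        ∫⁻ u, ∫⁻ v, h (u, v) * s (u, v) ∂(Q y) ∂(Q x) ≤ ∫⁻ p, s p ∂(T (x, y)) := by
  let g : X × X → X × X → ℝ≥0∞ := fun p q => h q +
    (1 - ∫⁻ v, h (q.1, v) ∂(Q p.2)) * (1 - ∫⁻ u, h (u, q.2) ∂(Q p.1)) *
      (1 - ∫⁻ u, ∫⁻ v, h (u, v) ∂(Q p.2) ∂(Q p.1))⁻¹
  have hg : Measurable (Function.uncurry g) := by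
    have m1 : Measurable fun z : X × X => ∫⁻ v, h (z.1, v) ∂(Q z.2) :=
      Measurable.lintegral_kernel_prod_right' (κ := Q.comap Prod.snd measurable_snd)
        (f := fun z : (X × X) × X => h (z.1.1, z.2)) (by fun_prop)
    have m2 : Measurable fun z : X × X => ∫⁻ u, h (u, z.1) ∂(Q z.2) :=
      Measurable.lintegral_kernel_prod_right' (κ := Q.comap Prod.snd measurable_snd)
        (f := fun z : (X × X) × X => h (z.2, z.1.1)) (by fun_prop)
    have m3 : Measurable fun p : X × X => ∫⁻ u, ∫⁻ v, h (u, v) ∂(Q p.2) ∂(Q p.1) :=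
      Measurable.lintegral_kernel_prod_right' (κ := Q.comap Prod.fst measurable_fst)
        (f := fun z : (X × X) × X => ∫⁻ v, h (z.2, v) ∂(Q z.1.2))
        (m1.comp (measurable_snd.prodMk (measurable_snd.comp measurable_fst)))
    have e1 := m1.comp (f := fun z : (X × X) × (X × X) => (z.2.1, z.1.2)) (by fun_prop)
    have e2 := m2.comp (f := fun z : (X × X) × (X × X) => (z.2.2, z.1.1)) (by fun_prop)
    have e3 := m3.comp (f := fun z : (X × X) × (X × X) => z.1) (by fun_prop)
    exact (hh.comp measurable_snd).add
      (((measurable_const.sub e1).mul (measurable_const.sub e2)).mul (measurable_const.sub e3).inv)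
  refine ⟨Kernel.withDensity (Q ∥ₖ Q) g, fun x y h1 h2 hm => ?_⟩
  rw [Kernel.withDensity_apply _ hg, Kernel.parallelComp_apply]
  refine ⟨isCoupling_withDensity _ _ hh h1 h2 hm, fun s hs => ?_⟩
  have hgx : Measurable (g (x, y)) := Measurable.of_uncurry_left hg
  rw [lintegral_withDensity_eq_lintegral_mul _ hgx hs,
    lintegral_prod _ (hgx.mul hs).aemeasurable]
  refine lintegral_mono fun u => lintegral_mono fun v => ?_
  exact mul_le_mul_left le_self_add _

lemma tsum_tsum_mul_inv_mul_le_one {P : ℕ → ℕ → ℝ≥0∞} {a ψ : ℕ → ℝ≥0∞}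
    (hP : ∀ i, ∑' j, P i j ≤ a i) (hψ : ∑' i, ψ i = 1) :
    ∑' i, ∑' j, P i j * (a i)⁻¹ * ψ i ≤ 1 := by
  rw [← hψ]
  refine ENNReal.tsum_le_tsum fun i => ?_
  rw [ENNReal.tsum_mul_right, ENNReal.tsum_mul_right]
  calc (∑' j, P i j) * (a i)⁻¹ * ψ i ≤ a i * (a i)⁻¹ * ψ i := by gcongr; exact hP i
    _ ≤ 1 * ψ i := by gcongr; exact ENNReal.mul_inv_le_one _
    _ = ψ i := one_mul _

/-- For a Feller kernel, the integral of a continuous `[0, 1]`-valued function against a coupling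
at a point is almost attained by a measurable family of couplings near that point. -/
lemma exists_kernel_eventually_isCoupling {X : Type*} [TopologicalSpace X] [PolishSpace X]
    [MeasurableSpace X] [BorelSpace X] (Q : Kernel X X) [IsMarkovKernel Q]
    (hFeller : ∀ f : X →ᵇ ℝ, Continuous (fun x => ∫ y, f y ∂(Q x)))
    {s : X × X → ℝ≥0∞} (hs : Continuous s) (hs1 : ∀ p, s p ≤ 1) {x₀ y₀ : X}
    {π : Measure (X × X)} (hπ : IsCoupling π (Q x₀) (Q y₀)) {c : ℝ≥0∞}
    (hc : c < ∫⁻ p, s p ∂π) :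
    ∃ T : Kernel (X × X) (X × X), ∀ᶠ p in 𝓝 (x₀, y₀),
      IsCoupling (T p) (Q p.1) (Q p.2) ∧ c < ∫⁻ q, s q ∂(T p) := by
  obtain ⟨φ, w, F, hφc, hφ1, hw1, hw, hF⟩ := exists_finset_sum_lt π hs hs1 hc
  have hφm (i : ℕ) : Measurable fun u => (φ i u : ℝ≥0∞) := (hφc i).measurable.coe_nnreal_ennreal
  have hφle (i : ℕ) (u : X) : (φ i u : ℝ≥0∞) ≤ 1 := hφ1 u ▸ ENNReal.le_tsum i
  set A : ℕ → X → ℝ≥0∞ := fun i x => ∫⁻ u, φ i u ∂(Q x) with hA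
  have hAle (i : ℕ) (x : X) : A i x ≤ 1 :=
    (lintegral_mono (hφle i)).trans_eq (by simp)
  have hAt (i : ℕ) (x : X) : A i x ≠ ∞ := ne_top_of_le_ne_top ENNReal.one_ne_top (hAle i x)
  have hAc (i : ℕ) : Continuous (A i) := by
    let f : X →ᵇ ℝ := BoundedContinuousFunction.ofNormedAddCommGroup (fun u => (φ i u : ℝ))
      (NNReal.continuous_coe.comp (hφc i)) 1 (fun u => by
        have := hφle i u
        norm_cast at this
        simpa using this)
    have hAf : A i = fun x => ENNReal.ofReal (∫ y, f y ∂(Q x)) := by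
      funext x
      rw [ofReal_integral_eq_lintegral_ofReal (f.integrable _) (ae_of_all _ fun u => (φ i u).2)]
      exact lintegral_congr fun u => (ENNReal.ofReal_coe_nnreal).symm
    rw [hAf]
    exact ENNReal.continuous_ofReal.comp (hFeller f)
  set P : ℕ × ℕ → ℝ≥0∞ := fun k => ∫⁻ p, φ k.1 p.1 * φ k.2 p.2 ∂π with hPdef
  have hP1 (i : ℕ) : ∑' j, P (i, j) = A i x₀ := by
    rw [hPdef, ← lintegral_tsum (fun j => by have := hφm i; have := hφm j; fun_prop)]
    simp_rw [ENNReal.tsum_mul_left, hφ1, mul_one]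
    simp only [hA]
    rw [← hπ.1]
    exact (lintegral_map (hφm i) measurable_fst).symm
  have hP2 (j : ℕ) : ∑' i, P (i, j) = A j y₀ := by
    rw [hPdef, ← lintegral_tsum (fun i => by have := hφm i; have := hφm j; fun_prop)]
    simp_rw [ENNReal.tsum_mul_right, hφ1, one_mul]
    simp only [hA]
    rw [← hπ.2]
    exact (lintegral_map (hφm j) measurable_snd).symm
  have hPle1 (k : ℕ × ℕ) : P k ≤ A k.1 x₀ :=
    hP1 k.1 ▸ ENNReal.le_tsum (f := fun j => P (k.1, j)) k.2
  have hPle2 (k : ℕ × ℕ) : P k ≤ A k.2 y₀ :=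
    hP2 k.2 ▸ ENNReal.le_tsum (f := fun i => P (i, k.2)) k.1
  obtain ⟨τ, hτ1, hτ⟩ : ∃ τ : ℝ≥0∞, τ < 1 ∧ c < ∑ k ∈ F, w k * (τ * τ * P k) := by
    have hcont : ContinuousAt (fun τ : ℝ≥0∞ => ∑ k ∈ F, w k * (τ * τ * P k)) 1 := by
      refine tendsto_finsetSum _ fun k _ => ?_
      have hPt : P k ≠ ∞ := ne_top_of_le_ne_top (hAt _ _) (hPle1 k)
      have hwt : w k ≠ ∞ := ne_top_of_le_ne_top ENNReal.one_ne_top (hw1 k)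
      exact ENNReal.Tendsto.const_mul (ENNReal.Tendsto.mul_const
        (ENNReal.Tendsto.mul tendsto_id (by simp) tendsto_id (by simp)) (Or.inr hPt)) (Or.inr hwt)
    have hev := continuousAt_const.eventually_lt hcont (by simpa using hF)
    have : (𝓝[<] (1 : ℝ≥0∞)).NeBot := nhdsLT_neBot_of_exists_lt ⟨0, zero_lt_one⟩
    obtain ⟨τ, h1, h2⟩ := ((hev.filter_mono nhdsWithin_le_nhds).and
      (self_mem_nhdsWithin (s := Set.Iio (1 : ℝ≥0∞)))).exists
    exact ⟨τ, h2, h1⟩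
  set C : ℕ × ℕ → ℝ≥0∞ := fun k => τ * τ * P k * (A k.1 x₀)⁻¹ * (A k.2 y₀)⁻¹ with hC
  have hC0 {k : ℕ × ℕ} (hk : P k = 0) : C k = 0 := by simp [hC, hk]
  have ha0 {k : ℕ × ℕ} (hk : P k ≠ 0) : A k.1 x₀ ≠ 0 := fun h =>
    hk (le_antisymm (h ▸ hPle1 k) zero_le)
  have hb0 {k : ℕ × ℕ} (hk : P k ≠ 0) : A k.2 y₀ ≠ 0 := fun h =>
    hk (le_antisymm (h ▸ hPle2 k) zero_le)
  have hCt (k : ℕ × ℕ) : C k ≠ ∞ := by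
    by_cases hk : P k = 0
    · simp [hC0 hk]
    have hPt : P k ≠ ∞ := ne_top_of_le_ne_top (hAt _ _) (hPle1 k)
    have hτt : τ ≠ ∞ := ne_top_of_lt hτ1
    have h3 := ENNReal.inv_ne_top.2 (ha0 hk)
    have h4 := ENNReal.inv_ne_top.2 (hb0 hk)
    finiteness
  let h : X × X → ℝ≥0∞ := fun q => ∑ k ∈ F, C k * (φ k.1 q.1 * φ k.2 q.2)
  have hh : Measurable h := by
    refine Finset.measurable_fun_sum _ fun k _ => ?_
    have := hφm k.1
    have := hφm k.2
    fun_prop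
  obtain ⟨T, hT⟩ := exists_kernel_of_density Q hh
  refine ⟨T, ?_⟩
  have hev1 : ∀ᶠ p in 𝓝 (x₀, y₀), ∀ k ∈ F, P k ≠ 0 → τ * A k.1 p.1 < A k.1 x₀ := by
    refine (Finset.eventually_all F).2 fun k _ => ?_
    by_cases hk : P k = 0
    · simp [hk]
    have hcont : Continuous fun p : X × X => τ * A k.1 p.1 :=
      (ENNReal.continuous_const_mul (ne_top_of_lt hτ1)).comp ((hAc _).comp continuous_fst)
    have hlt : τ * A k.1 x₀ < A k.1 x₀ := by
      simpa using ENNReal.mul_lt_mul_left (ha0 hk) (hAt _ _) hτ1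
    filter_upwards [hcont.continuousAt.eventually_lt continuousAt_const hlt] with p hp _ using hp
  have hev2 : ∀ᶠ p in 𝓝 (x₀, y₀), ∀ k ∈ F, P k ≠ 0 → τ * A k.2 p.2 < A k.2 y₀ := by
    refine (Finset.eventually_all F).2 fun k _ => ?_
    by_cases hk : P k = 0
    · simp [hk]
    have hcont : Continuous fun p : X × X => τ * A k.2 p.2 :=
      (ENNReal.continuous_const_mul (ne_top_of_lt hτ1)).comp ((hAc _).comp continuous_snd)
    have hlt : τ * A k.2 y₀ < A k.2 y₀ := by
      simpa using ENNReal.mul_lt_mul_left (hb0 hk) (hAt _ _) hτ1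
    filter_upwards [hcont.continuousAt.eventually_lt continuousAt_const hlt] with p hp _ using hp
  have hev3 : ∀ᶠ p in 𝓝 (x₀, y₀), c < ∑ k ∈ F, w k * (C k * (A k.1 p.1 * A k.2 p.2)) := by
    have hcont : Continuous fun p : X × X =>
        ∑ k ∈ F, w k * (C k * (A k.1 p.1 * A k.2 p.2)) := by
      refine continuous_finsetSum _ fun k _ => ?_
      refine (ENNReal.continuous_const_mul
        (ne_top_of_le_ne_top ENNReal.one_ne_top (hw1 k))).comp
        ((ENNReal.continuous_const_mul (hCt k)).comp ?_)
      exact continuous_iff_continuousAt.2 fun p => ENNReal.Tendsto.mul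
        ((hAc _).comp continuous_fst).continuousAt (Or.inr (hAt _ _))
        ((hAc _).comp continuous_snd).continuousAt (Or.inr (hAt _ _))
    refine continuousAt_const.eventually_lt hcont.continuousAt (hτ.trans_le ?_)
    refine Finset.sum_le_sum fun k _ => mul_le_mul_right ?_ _
    by_cases hk : P k = 0
    · simp [hk]
    · refine le_of_eq ?_
      calc τ * τ * P k = τ * τ * P k * ((A k.1 x₀)⁻¹ * A k.1 x₀) * ((A k.2 y₀)⁻¹ * A k.2 y₀) := by
            rw [ENNReal.inv_mul_cancel (ha0 hk) (hAt _ _),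
              ENNReal.inv_mul_cancel (hb0 hk) (hAt _ _), mul_one, mul_one]
        _ = C k * (A k.1 x₀ * A k.2 y₀) := by rw [hC]; ring
  filter_upwards [hev1, hev2, hev3] with p hp1 hp2 hp3
  have hI1 (u : X) : ∫⁻ v, h (u, v) ∂(Q p.2) = ∑ k ∈ F, C k * (φ k.1 u * A k.2 p.2) := by
    rw [lintegral_finsetSum _ fun k _ => by have := hφm k.2; fun_prop]
    refine Finset.sum_congr rfl fun k _ => ?_
    rw [lintegral_const_mul _ (by have := hφm k.2; fun_prop)]
    exact congrArg (C k * ·) (lintegral_const_mul (φ k.1 u : ℝ≥0∞) (hφm k.2))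
  have hI2 (v : X) : ∫⁻ u, h (u, v) ∂(Q p.1) = ∑ k ∈ F, C k * (A k.1 p.1 * φ k.2 v) := by
    rw [lintegral_finsetSum _ fun k _ => by have := hφm k.1; fun_prop]
    refine Finset.sum_congr rfl fun k _ => ?_
    rw [lintegral_const_mul _ (by have := hφm k.1; fun_prop)]
    exact congrArg (C k * ·) (lintegral_mul_const (φ k.2 v : ℝ≥0∞) (hφm k.1))
  have hb1 (u : X) : ∫⁻ v, h (u, v) ∂(Q p.2) ≤ τ := by
    rw [hI1]
    calc ∑ k ∈ F, C k * (φ k.1 u * A k.2 p.2)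
        ≤ ∑ k ∈ F, τ * (P k * (A k.1 x₀)⁻¹ * φ k.1 u) := by
          refine Finset.sum_le_sum fun k hk => ?_
          by_cases hk0 : P k = 0
          · simp [hC0 hk0]
          calc C k * (φ k.1 u * A k.2 p.2)
              = τ * (P k * (A k.1 x₀)⁻¹ * φ k.1 u) * (τ * A k.2 p.2 * (A k.2 y₀)⁻¹) := by
                rw [hC]; ring
            _ ≤ τ * (P k * (A k.1 x₀)⁻¹ * φ k.1 u) * (A k.2 y₀ * (A k.2 y₀)⁻¹) := by
                gcongr; exact (hp2 k hk hk0).le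
            _ ≤ _ := mul_le_of_le_one_right' (ENNReal.mul_inv_le_one _)
      _ ≤ τ * ∑' k : ℕ × ℕ, P k * (A k.1 x₀)⁻¹ * φ k.1 u := by
          rw [← Finset.mul_sum]; gcongr; exact ENNReal.sum_le_tsum F
      _ ≤ τ := by
          refine mul_le_of_le_one_right' ?_
          rw [ENNReal.tsum_prod (f := fun i j => P (i, j) * (A i x₀)⁻¹ * φ i u)]
          exact tsum_tsum_mul_inv_mul_le_one (P := fun i j => P (i, j))
            (fun i => (hP1 i).le) (hφ1 u)
  have hb2 (v : X) : ∫⁻ u, h (u, v) ∂(Q p.1) ≤ τ := by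
    rw [hI2]
    calc ∑ k ∈ F, C k * (A k.1 p.1 * φ k.2 v)
        ≤ ∑ k ∈ F, τ * (P k * (A k.2 y₀)⁻¹ * φ k.2 v) := by
          refine Finset.sum_le_sum fun k hk => ?_
          by_cases hk0 : P k = 0
          · simp [hC0 hk0]
          calc C k * (A k.1 p.1 * φ k.2 v)
              = τ * (P k * (A k.2 y₀)⁻¹ * φ k.2 v) * (τ * A k.1 p.1 * (A k.1 x₀)⁻¹) := by
                rw [hC]; ring
            _ ≤ τ * (P k * (A k.2 y₀)⁻¹ * φ k.2 v) * (A k.1 x₀ * (A k.1 x₀)⁻¹) := by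
                gcongr; exact (hp1 k hk hk0).le
            _ ≤ _ := mul_le_of_le_one_right' (ENNReal.mul_inv_le_one _)
      _ ≤ τ * ∑' k : ℕ × ℕ, P k * (A k.2 y₀)⁻¹ * φ k.2 v := by
          rw [← Finset.mul_sum]; gcongr; exact ENNReal.sum_le_tsum F
      _ ≤ τ := by
          refine mul_le_of_le_one_right' ?_
          rw [ENNReal.tsum_prod (f := fun i j => P (i, j) * (A j y₀)⁻¹ * φ j v),
            ENNReal.tsum_comm]
          exact tsum_tsum_mul_inv_mul_le_one (P := fun j i => P (i, j))
            (fun j => (hP2 j).le) (hφ1 v)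
  have hmass : ∫⁻ u, ∫⁻ v, h (u, v) ∂(Q p.2) ∂(Q p.1) < 1 :=
    ((lintegral_mono hb1).trans_eq (by simp)).trans_lt hτ1
  obtain ⟨hT1, hT2⟩ := hT p.1 p.2 (fun u => (hb1 u).trans hτ1.le) (fun v => (hb2 v).trans hτ1.le)
    hmass
  refine ⟨hT1, hp3.trans_le (le_trans ?_ (hT2 s hs.measurable))⟩
  calc ∑ k ∈ F, w k * (C k * (A k.1 p.1 * A k.2 p.2))
      = ∫⁻ u, ∫⁻ v, ∑ k ∈ F, w k * (C k * (φ k.1 u * φ k.2 v)) ∂(Q p.2) ∂(Q p.1) := by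
        have hin (u : X) : ∫⁻ v, ∑ k ∈ F, w k * (C k * (φ k.1 u * φ k.2 v)) ∂(Q p.2) =
            ∑ k ∈ F, w k * (C k * (φ k.1 u * A k.2 p.2)) := by
          rw [lintegral_finsetSum _ fun k _ => by have := hφm k.2; fun_prop]
          refine Finset.sum_congr rfl fun k _ => ?_
          rw [lintegral_const_mul _ (by have := hφm k.2; fun_prop),
            lintegral_const_mul _ (by have := hφm k.2; fun_prop), lintegral_const_mul _ (hφm k.2)]
        simp_rw [hin]
        rw [lintegral_finsetSum _ fun k _ => by have := hφm k.1; fun_prop]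
        refine Finset.sum_congr rfl fun k _ => ?_
        rw [lintegral_const_mul _ (by have := hφm k.1; fun_prop),
          lintegral_const_mul _ (by have := hφm k.1; fun_prop), lintegral_mul_const _ (hφm k.1)]
    _ ≤ ∫⁻ u, ∫⁻ v, h (u, v) * s (u, v) ∂(Q p.2) ∂(Q p.1) := by
        refine lintegral_mono fun u => lintegral_mono fun v => ?_
        simp only [h, Finset.sum_mul]
        refine Finset.sum_le_sum fun k _ => ?_
        calc w k * (C k * (φ k.1 u * φ k.2 v)) = C k * (w k * (φ k.1 u * φ k.2 v)) := by ring
          _ ≤ C k * (s (u, v) * (φ k.1 u * φ k.2 v)) := mul_le_mul_right (hw k u v) _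
          _ = _ := by ring

lemma IsCoupling.isProbabilityMeasure {α β : Type*} [MeasurableSpace α] [MeasurableSpace β]
    {π : Measure (α × β)} {μ : Measure α} {ν : Measure β} [IsProbabilityMeasure μ]
    (h : IsCoupling π μ ν) : IsProbabilityMeasure π := by
  constructor
  rw [← Set.preimage_univ (f := Prod.fst), ← Measure.map_apply measurable_fst .univ, h.1]
  exact measure_univ

lemma lintegral_ofReal_one_sub {E : Type*} [MeasurableSpace E] (π : Measure E)
    [IsProbabilityMeasure π] {f : E → ℝ} (hf : Measurable f) (h0 : ∀ p, 0 ≤ f p)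
    (h1 : ∀ p, f p ≤ 1) :
    ∫⁻ p, ENNReal.ofReal (1 - f p) ∂π = 1 - ∫⁻ p, ENNReal.ofReal (f p) ∂π := by
  have hle (p : E) : ENNReal.ofReal (f p) ≤ 1 := ENNReal.ofReal_le_one.2 (h1 p)
  have hfin : ∫⁻ p, ENNReal.ofReal (f p) ∂π ≠ ∞ :=
    ne_top_of_le_ne_top ENNReal.one_ne_top ((lintegral_mono hle).trans_eq (by simp))
  simp_rw [ENNReal.ofReal_sub 1 (h0 _), ENNReal.ofReal_one]
  rw [lintegral_sub hf.ennreal_ofReal hfin (ae_of_all _ hle)]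
  simp

/-- **Lemma 4.14.** If `Q` is a Feller Markov kernel on a Polish space and `d` is a
continuous `[0,1]`-valued distance-like function which is contracting for `Q` with constant
`α < 1`, then there exist `α̃ < 1` and a Markov kernel `T` on `X × X` whose transition
probabilities are couplings of those of `Q` and which contracts `d` by the factor `α̃`
whenever `d(x,y) < 1`. -/
theorem stmt_10 {X : Type*} [TopologicalSpace X] [PolishSpace X]
    [MeasurableSpace X] [BorelSpace X]
    (Q : Kernel X X) [IsMarkovKernel Q]
    (hFeller : ∀ f : X →ᵇ ℝ, Continuous (fun x => ∫ y, f y ∂(Q x)))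
    (d : X → X → ℝ)
    (hd_cont : Continuous (fun p : X × X => d p.1 p.2))
    (hd_symm : ∀ x y, d x y = d y x)
    (hd_eq_zero : ∀ x y, d x y = 0 ↔ x = y)
    (hd_nonneg : ∀ x y, 0 ≤ d x y) (hd_le_one : ∀ x y, d x y ≤ 1)
    (α : ℝ) (hα : α < 1)
    (hcontract : ∀ x y, d x y < 1 →
      liftDist d (Q x) (Q y) ≤ ENNReal.ofReal (α * d x y)) :
    ∃ αt : ℝ, αt < 1 ∧ ∃ T : Kernel (X × X) (X × X), IsMarkovKernel T ∧
      (∀ x y : X, IsCoupling (T (x, y)) (Q x) (Q y)) ∧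
      ∀ x y : X, d x y < 1 →
        ∫⁻ p, ENNReal.ofReal (d p.1 p.2) ∂(T (x, y)) ≤ ENNReal.ofReal (αt * d x y) := by
  obtain ⟨β, hβ, hβ1⟩ := exists_between (max_lt hα zero_lt_one)
  obtain ⟨hαβ, hβ0⟩ := max_lt_iff.1 hβ
  let good (m : Measure (X × X)) (p : X × X) : Prop := IsCoupling m (Q p.1) (Q p.2) ∧
    (d p.1 p.2 < 1 →
      ∫⁻ q, ENNReal.ofReal (d q.1 q.2) ∂m ≤ ENNReal.ofReal (β * d p.1 p.2))
  have hcompl (π : Measure (X × X)) [IsProbabilityMeasure π] :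
      ∫⁻ q, ENNReal.ofReal (1 - d q.1 q.2) ∂π = 1 - ∫⁻ q, ENNReal.ofReal (d q.1 q.2) ∂π :=
    lintegral_ofReal_one_sub π hd_cont.measurable (fun _ => hd_nonneg _ _)
      (fun _ => hd_le_one _ _)
  have hofReal (p : X × X) :
      ENNReal.ofReal (1 - β * d p.1 p.2) = 1 - ENNReal.ofReal (β * d p.1 p.2) := by
    rw [ENNReal.ofReal_sub _ (mul_nonneg hβ0.le (hd_nonneg _ _)), ENNReal.ofReal_one]
  have hlocal (p : {p : X × X // 0 < d p.1 p.2 ∧ d p.1 p.2 < 1}) :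
      ∃ V : Set (X × X), IsOpen V ∧ (p : X × X) ∈ V ∧
        ∃ T : Kernel (X × X) (X × X), ∀ q ∈ V, good (T q) q := by
    obtain ⟨⟨x, y⟩, hp0, hp1⟩ := p
    have hlt : liftDist d (Q x) (Q y) < ENNReal.ofReal (β * d x y) :=
      (hcontract x y hp1).trans_lt ((ENNReal.ofReal_lt_ofReal_iff (mul_pos hβ0 hp0)).2
        (mul_lt_mul_of_pos_right hαβ hp0))
    obtain ⟨_, ⟨π, hπ, rfl⟩, hπlt⟩ := sInf_lt_iff.1 hlt
    have := hπ.isProbabilityMeasure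
    have hs : ENNReal.ofReal (1 - β * d x y) < ∫⁻ q, ENNReal.ofReal (1 - d q.1 q.2) ∂π := by
      rw [hcompl, hofReal (x, y)]
      refine (ENNReal.cancel_of_ne ENNReal.ofReal_ne_top).tsub_lt_tsub_left_of_le ?_ hπlt
      exact ENNReal.ofReal_le_one.2 (mul_le_one₀ hβ1.le (hd_nonneg _ _) (hd_le_one _ _))
    obtain ⟨c, hc1, hc2⟩ := exists_between hs
    obtain ⟨T, hT⟩ := exists_kernel_eventually_isCoupling Q hFeller
      (s := fun q => ENNReal.ofReal (1 - d q.1 q.2))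
      (ENNReal.continuous_ofReal.comp (continuous_const.sub hd_cont))
      (fun q => ENNReal.ofReal_le_one.2 (by linarith [hd_nonneg q.1 q.2])) hπ hc2
    have hev : ∀ᶠ q : X × X in 𝓝 (x, y), ENNReal.ofReal (1 - β * d q.1 q.2) < c :=
      (ENNReal.continuous_ofReal.comp (continuous_const.sub
        (continuous_const.mul hd_cont))).continuousAt.eventually_lt continuousAt_const hc1
    obtain ⟨V, hV, hVo, hmem⟩ := eventually_nhds_iff.1 (hT.and hev)
    refine ⟨V, hVo, hmem, T, fun q hq => ?_⟩
    obtain ⟨⟨hcoup, hcq⟩, hqc⟩ := hV q hq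
    refine ⟨hcoup, fun _ => ?_⟩
    have := hcoup.isProbabilityMeasure
    have hlt' := hqc.trans hcq
    rw [hcompl, hofReal] at hlt'
    exact (lt_of_tsub_lt_tsub_left hlt').le
  choose V hVo hVmem K hK using hlocal
  obtain ⟨I, hI, hIV⟩ := TopologicalSpace.isOpen_iUnion_countable V hVo
  let D : Kernel (X × X) (X × X) :=
    (Q.map fun u => (u, u)).comap Prod.fst measurable_fst
  let 𝒞 : Set (Set (X × X) × Kernel (X × X) (X × X)) :=
    {({p | d p.1 p.2 = 0}, D), ({p | d p.1 p.2 = 1}, Q ∥ₖ Q)} ∪ (fun p => (V p, K p)) '' I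
  obtain ⟨f, hf⟩ : ∃ f : ℕ → _, 𝒞 = Set.range f :=
    (((Set.countable_singleton _).insert _).union (hI.image _)).exists_eq_range
      ⟨_, Or.inl (Set.mem_insert _ _)⟩
  have h𝒞 : ∀ z ∈ 𝒞, MeasurableSet z.1 ∧ ∀ p ∈ z.1, good (z.2 p) p := by
    rintro z ((rfl | rfl) | ⟨p, -, rfl⟩)
    · refine ⟨measurableSet_eq_fun hd_cont.measurable measurable_const, ?_⟩
      rintro ⟨x, y⟩ (hxy : d x y = 0)
      obtain rfl := (hd_eq_zero x y).1 hxy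
      have hdiag : Measurable fun u : X => (u, u) := measurable_id.prodMk measurable_id
      have hD : D (x, x) = (Q x).map fun u => (u, u) := by
        simp only [D, Kernel.comap_apply, Kernel.map_apply _ hdiag]
      refine ⟨⟨?_, ?_⟩, fun _ => ?_⟩
      · rw [hD, Measure.map_map measurable_fst hdiag]
        exact Measure.map_id
      · rw [hD, Measure.map_map measurable_snd hdiag]
        exact Measure.map_id
      · rw [hD, lintegral_map hd_cont.measurable.ennreal_ofReal hdiag]
        simp [(hd_eq_zero _ _).2]
    · refine ⟨measurableSet_eq_fun hd_cont.measurable measurable_const, ?_⟩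
      rintro ⟨x, y⟩ (hxy : d x y = 1)
      refine ⟨?_, fun h => absurd hxy h.ne⟩
      rw [Kernel.parallelComp_apply]
      exact ⟨by simp, by simp⟩
    · exact ⟨(hVo p).measurableSet, hK p⟩
  have hfgood (n : ℕ) := h𝒞 (f n) (hf ▸ Set.mem_range_self n)
  have hcover (p : X × X) : ∃ n, p ∈ (f n).1 := by
    suffices ∃ z ∈ 𝒞, p ∈ z.1 by
      obtain ⟨z, hz, hp⟩ := this
      rw [hf] at hz
      obtain ⟨n, rfl⟩ := hz
      exact ⟨n, hp⟩
    rcases (hd_nonneg p.1 p.2).eq_or_lt with h0 | h0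
    · exact ⟨_, Or.inl (Or.inl rfl), h0.symm⟩
    rcases (hd_le_one p.1 p.2).eq_or_lt with h1 | h1
    · exact ⟨_, Or.inl (Or.inr rfl), h1⟩
    have hmem : p ∈ ⋃ i ∈ I, V i := hIV ▸ Set.mem_iUnion.2 ⟨⟨p, h0, h1⟩, hVmem _⟩
    obtain ⟨i, hi, hpi⟩ := Set.mem_iUnion₂.1 hmem
    exact ⟨_, Or.inr ⟨i, hi, rfl⟩, hpi⟩
  obtain ⟨T, hT⟩ := Kernel.exists_forall_eq_of_cover (fun n => (f n).2) (fun n => (f n).1)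
    (fun n => (hfgood n).1) hcover
  have hTgood (p : X × X) : good (T p) p := by
    obtain ⟨n, hn, heq⟩ := hT p
    exact heq ▸ (hfgood n).2 p hn
  exact ⟨β, hβ1, T, ⟨fun p => (hTgood p).1.isProbabilityMeasure⟩, fun x y => (hTgood (x, y)).1,
    fun x y => (hTgood (x, y)).2⟩
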